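/- arXiv:2201.05316 — 2 statements merged into one kernel-verified Lean document; each statement's English description precedes it below -/
import Mathlib

section
/- Let (Ω,𝒜,ν) be a probability space, q>0 with q≠1, and let ξ : Ω → ℝ be a bounded measurable function. Then for all sufficiently small γ > 0 the quantity CE(ξ,γ) = −(1/γ) ln_q( ∫ exp_q(−γξ) dν ) is well defined, and lim_{γ → 0⁺} CE(ξ,γ) = ∫ ξ dν. -/
open Real Set Filter MeasureTheory

/-- The `q`-logarithm: `ln_q(x) = (x^(1-q) - 1)/(1-q)`. -/
noncomputable def lnq (q x : ℝ) : ℝ := (x ^ (1 - q) - 1) / (1 - q)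

/-- The `q`-exponential: `exp_q(x) = (1 + (1-q) x)^(1/(1-q))`. -/
noncomputable def expq (q x : ℝ) : ℝ := (1 + (1 - q) * x) ^ (1 / (1 - q))

theorem hasDerivAt_lnq {q x : ℝ} (hq1 : q ≠ 1) (hx : 0 < x) :
    HasDerivAt (lnq q) (x ^ (-q)) x := by
  have h1 : 1 - q ≠ 0 := sub_ne_zero.mpr hq1.symm
  have h := ((Real.hasDerivAt_rpow_const (p := 1 - q) (Or.inl hx.ne')).sub_const 1).div_const
    (1 - q)
  refine HasDerivAt.congr_deriv (f := lnq q) h ?_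
  rw [mul_div_cancel_left₀ _ h1, show (1 - q - 1 : ℝ) = -q by ring]

theorem hasDerivAt_expq {q x : ℝ} (hq1 : q ≠ 1) (hx : 0 < 1 + (1 - q) * x) :
    HasDerivAt (expq q) ((1 + (1 - q) * x) ^ (1 / (1 - q) - 1)) x := by
  have h1 : 1 - q ≠ 0 := sub_ne_zero.mpr hq1.symm
  have h := (((hasDerivAt_id x).const_mul (1 - q)).const_add 1).rpow_const
    (p := 1 / (1 - q)) (Or.inl hx.ne')
  refine HasDerivAt.congr_deriv (f := expq q) h ?_
  rw [mul_one, mul_one_div_cancel h1, one_mul, id_eq]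

theorem measurable_expq (q : ℝ) : Measurable (expq q) := by
  unfold expq
  fun_prop

theorem expq_zero (q : ℝ) : expq q 0 = 1 := by simp [expq]

theorem lnq_one (q : ℝ) : lnq q 1 = 0 := by simp [lnq]

/-- For a uniformly bounded argument, the base of the `q`-exponential stays close to `1`
when `γ` is close to `0`. -/
theorem exists_expq_base_mem_Icc (q C : ℝ) :
    ∃ ε > 0, ∀ γ : ℝ, |γ| < ε → ∀ y : ℝ, |y| ≤ C →
      1 + (1 - q) * (-γ * y) ∈ Icc (1 / 2 : ℝ) (3 / 2) := by
  have hpos : 0 < |1 - q| * |C| + 1 := by positivity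
  refine ⟨1 / (2 * (|1 - q| * |C| + 1)), by positivity, fun γ hγ y hy ↦ ?_⟩
  have hle : |(1 - q) * (-γ * y)| ≤ 1 / 2 := by
    have hγ' : |γ| * (|1 - q| * |C| + 1) < 1 / 2 := by
      rw [lt_div_iff₀ (by positivity)] at hγ
      linarith
    calc |(1 - q) * (-γ * y)| = |γ| * (|1 - q| * |y|) := by
          rw [abs_mul, abs_mul, abs_neg]; ring
      _ ≤ |γ| * (|1 - q| * |C| + 1) := by
          have : |y| ≤ |C| := hy.trans (le_abs_self C)
          gcongr
          have := mul_le_mul_of_nonneg_left this (abs_nonneg (1 - q))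
          linarith
      _ ≤ 1 / 2 := hγ'.le
  obtain ⟨h1, h2⟩ := abs_le.mp hle
  constructor <;> linarith

theorem hasDerivAt_integral_expq {Ω : Type*} [MeasurableSpace Ω] (ν : Measure Ω)
    [IsProbabilityMeasure ν] {q : ℝ} (hq1 : q ≠ 1) {ξ : Ω → ℝ} (hξ : Measurable ξ)
    {C : ℝ} (hC : ∀ ω, |ξ ω| ≤ C) :
    HasDerivAt (fun γ : ℝ ↦ ∫ ω, expq q (-γ * ξ ω) ∂ν) (-∫ ω, ξ ω ∂ν) 0 := by
  obtain ⟨ε, hε, hbase⟩ := exists_expq_base_mem_Icc q C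
  obtain ⟨M, hM⟩ := (isCompact_Icc (a := (1 / 2 : ℝ)) (b := 3 / 2)).exists_bound_of_continuousOn
    (f := fun u : ℝ ↦ u ^ (1 / (1 - q) - 1)) (fun u hu ↦
      (Real.continuousAt_rpow_const u _
        (Or.inl (by have := hu.1; linarith))).continuousWithinAt)
  have hmeas (γ : ℝ) : Measurable fun ω ↦ expq q (-γ * ξ ω) :=
    (measurable_expq q).comp (hξ.const_mul _)
  have h := (hasDerivAt_integral_of_dominated_loc_of_deriv_le (μ := ν) (𝕜 := ℝ)
    (F := fun γ ω ↦ expq q (-γ * ξ ω))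
    (F' := fun γ ω ↦ (1 + (1 - q) * (-γ * ξ ω)) ^ (1 / (1 - q) - 1) * -ξ ω)
    (bound := fun _ ↦ M * C) (x₀ := (0 : ℝ)) (Metric.ball_mem_nhds 0 hε)
    (.of_forall fun γ ↦ (hmeas γ).aestronglyMeasurable)
    (by simp [expq_zero])
    (Measurable.aestronglyMeasurable (by fun_prop))
    (.of_forall fun ω γ hγ ↦ ?_) (integrable_const _) (.of_forall fun ω γ hγ ↦ ?_)).2
  · simpa [integral_neg] using h
  · have hu := hM _ (hbase γ (by simpa using hγ) _ (hC ω))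
    rw [norm_mul, norm_neg]
    exact mul_le_mul hu (hC ω) (norm_nonneg _) ((norm_nonneg _).trans hu)
  · have hu := (hbase γ (by simpa using hγ) _ (hC ω)).1
    have hin : HasDerivAt (fun γ : ℝ ↦ -γ * ξ ω) (-ξ ω) γ := by
      simpa using (hasDerivAt_id γ).neg.mul_const (ξ ω)
    exact (hasDerivAt_expq hq1 (by linarith)).comp γ hin

/-- for a bounded measurable `ξ`, the certainty equivalent
`CE(ξ,γ) = -(1/γ) ln_q(∫ exp_q(-γξ) dν)` is well defined for all sufficiently
small `γ > 0` (the base `1 + (1-q)(-γξ)` is positive), and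
`CE(ξ,γ) → ∫ ξ dν` as `γ → 0⁺`. -/
theorem certainty_equivalent_small_gamma_limit {Ω : Type*} [MeasurableSpace Ω]
    (ν : MeasureTheory.Measure Ω) [IsProbabilityMeasure ν]
    (q : ℝ) (hq : 0 < q) (hq1 : q ≠ 1)
    (ξ : Ω → ℝ) (hξ : Measurable ξ)
    (C : ℝ) (hC : ∀ ω, |ξ ω| ≤ C) :
    (∀ᶠ γ : ℝ in nhdsWithin 0 (Set.Ioi 0),
      ∀ ω, 0 < 1 + (1 - q) * (-γ * ξ ω)) ∧
    Tendsto (fun γ : ℝ => -(1 / γ) * lnq q (∫ ω, expq q (-γ * ξ ω) ∂ν))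
      (nhdsWithin 0 (Set.Ioi 0)) (nhds (∫ ω, ξ ω ∂ν)) := by
  constructor
  · obtain ⟨ε, hε, hbase⟩ := exists_expq_base_mem_Icc q C
    filter_upwards [nhdsWithin_le_nhds (Metric.ball_mem_nhds (0 : ℝ) hε)] with γ hγ ω
    have := (hbase γ (by simpa using hγ) _ (hC ω)).1
    linarith
  · have h0 : (∫ ω, expq q (-(0 : ℝ) * ξ ω) ∂ν) = 1 := by simp [expq_zero]
    have hln : HasDerivAt (lnq q) 1 (∫ ω, expq q (-(0 : ℝ) * ξ ω) ∂ν) := by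
      rw [h0]
      simpa using hasDerivAt_lnq hq1 one_pos
    have hd := (hln.comp 0 (hasDerivAt_integral_expq ν hq1 hξ hC)).neg
    have ht := hd.tendsto_slope_zero_right
    simp only [Pi.neg_apply, Function.comp_apply, zero_add, neg_zero, zero_mul, expq_zero,
      integral_const, probReal_univ, lnq_one, sub_zero, one_mul, neg_neg,
      smul_eq_mul] at ht
    refine ht.congr fun γ ↦ ?_
    rw [one_div]
    ring
end

section
/- Let (Ω,𝒜,ν) be a probability space, 𝒢 ⊆ 𝒜 a sub-σ-algebra, q>0 with q≠1, and let ξ : Ω → ℝ be a bounded measurable function. Let (γ_n) be any sequence of positive reals tending to 0 such that exp_q(−γ_n ξ) is well defined for all n (which holds for all sufficiently small γ_n). Then ν-almost surely, lim_{n → ∞} −(1/γ_n) ln_q( E_ν[exp_q(−γ_n ξ) | 𝒢] ) = E_ν[ξ | 𝒢]. -/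
open Real Set Filter MeasureTheory

/-- The `q`-exponential has derivative `1` at `0`. -/
theorem hasDerivAt_expq_zero {q : ℝ} (hq1 : q ≠ 1) : HasDerivAt (expq q) 1 0 := by
  have h1 : (1 - q) ≠ 0 := sub_ne_zero.mpr hq1.symm
  have h := (((hasDerivAt_id (0 : ℝ)).const_mul (1 - q)).const_add 1).rpow_const
    (p := 1 / (1 - q)) (Or.inl (by simp))
  have h' : HasDerivAt (expq q) _ 0 := h
  exact h'.congr_deriv (by simp [h1])

/-- The `q`-logarithm has derivative `1` at `1`. -/
theorem hasDerivAt_lnq_one {q : ℝ} (hq1 : q ≠ 1) : HasDerivAt (lnq q) 1 1 := by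
  have h1 : (1 - q) ≠ 0 := sub_ne_zero.mpr hq1.symm
  have h := (((hasDerivAt_id (1 : ℝ)).rpow_const
    (p := 1 - q) (Or.inl (by simp))).sub_const 1).div_const (1 - q)
  have h' : HasDerivAt (lnq q) _ 1 := h
  exact h'.congr_deriv (by simp [h1])

/-- If `c n → c` and `γ n → 0` through positive values, then
`-(1 / γ n) * lnq q (1 - γ n * c n) → c`. -/
theorem tendsto_neg_inv_mul_lnq {q : ℝ} (hq1 : q ≠ 1) {γ : ℕ → ℝ} (hγpos : ∀ n, 0 < γ n)
    (hγ0 : Tendsto γ atTop (nhds 0)) {c : ℕ → ℝ} {a : ℝ} (hc : Tendsto c atTop (nhds a)) :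
    Tendsto (fun n => -(1 / γ n) * lnq q (1 - γ n * c n)) atTop (nhds a) := by
  have hd : Tendsto (fun n => -(γ n * c n)) atTop (nhds 0) := by
    simpa using (hγ0.mul hc).neg
  have hcd : Tendsto (fun n => -(1 / γ n) • (-(γ n * c n))) atTop (nhds a) := by
    refine hc.congr fun n => ?_
    have := (hγpos n).ne'
    rw [smul_eq_mul]
    field_simp
  have h := (hasDerivAt_lnq_one hq1).hasFDerivAt.hasFDerivWithinAt.lim (s := univ) hd
    (Eventually.of_forall fun _ => mem_univ _) hcd
  simpa [lnq, sub_eq_add_neg] using h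

/-- Difference quotients at `0` converge uniformly along a bounded function. -/
theorem tendstoUniformly_sub_div_of_hasDerivAt {Ω : Type*} {φ : ℝ → ℝ} (hφ : HasDerivAt φ 1 0)
    {ξ : Ω → ℝ} {C : ℝ} (hC : ∀ ω, |ξ ω| ≤ C) {γ : ℕ → ℝ} (hγpos : ∀ n, 0 < γ n)
    (hγ0 : Tendsto γ atTop (nhds 0)) :
    TendstoUniformly (fun n ω => (φ 0 - φ (-(γ n) * ξ ω)) / γ n) ξ atTop := by
  rw [Metric.tendstoUniformly_iff]
  intro ε hε
  rcases isEmpty_or_nonempty Ω with hΩ | ⟨⟨ω₀⟩⟩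
  · exact Eventually.of_forall fun _ ω => hΩ.elim ω
  have hC0 : 0 ≤ C := (abs_nonneg _).trans (hC ω₀)
  have hη : 0 < ε / (C + 1) := by positivity
  have ho := (hasDerivAt_iff_isLittleO.mp hφ).def hη
  obtain ⟨δ, hδ, hball⟩ := Metric.eventually_nhds_iff.mp ho
  have hsmall : Tendsto (fun n => γ n * C) atTop (nhds 0) := by simpa using hγ0.mul_const C
  filter_upwards [hsmall.eventually_lt_const hδ] with n hn ω
  have hγ := hγpos n
  have habs : |-(γ n) * ξ ω| = γ n * |ξ ω| := by
    rw [abs_mul, abs_neg, abs_of_pos hγ]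
  have hle : γ n * |ξ ω| ≤ γ n * C := mul_le_mul_of_nonneg_left (hC ω) hγ.le
  have hb := hball (y := -(γ n) * ξ ω) (by rw [Real.dist_0_eq_abs, habs]; linarith)
  simp only [sub_zero, smul_eq_mul, mul_one, Real.norm_eq_abs] at hb
  rw [habs] at hb
  have heq : ξ ω - (φ 0 - φ (-(γ n) * ξ ω)) / γ n
      = (φ (-(γ n) * ξ ω) - φ 0 - -(γ n) * ξ ω) / γ n := by
    field_simp
    ring
  rw [Real.dist_eq, heq, abs_div, abs_of_pos hγ, div_lt_iff₀ hγ]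
  calc _ ≤ ε / (C + 1) * (γ n * |ξ ω|) := hb
    _ ≤ ε / (C + 1) * (γ n * C) := mul_le_mul_of_nonneg_left hle hη.le
    _ < ε / (C + 1) * (γ n * (C + 1)) := by gcongr; linarith
    _ = ε * γ n := by field_simp

/-- Conditional expectations of a uniformly convergent sequence converge almost surely. -/
theorem TendstoUniformly.ae_tendsto_condExp {Ω : Type*} {m m0 : MeasurableSpace Ω}
    {ν : Measure Ω} [IsFiniteMeasure ν] {f : ℕ → Ω → ℝ} {g : Ω → ℝ}
    (hf : ∀ᶠ n in atTop, Integrable (f n) ν) (hg : Integrable g ν)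
    (hfg : TendstoUniformly f g atTop) :
    ∀ᵐ ω ∂ν, Tendsto (fun n => (ν[f n | m]) ω) atTop (nhds ((ν[g | m]) ω)) := by
  have key : ∀ᵐ ω ∂ν, ∀ n k : ℕ, Integrable (f n) ν →
      (∀ x, |f n x - g x| ≤ 1 / ((k : ℝ) + 1)) →
      |(ν[f n | m]) ω - (ν[g | m]) ω| ≤ 1 / ((k : ℝ) + 1) := by
    simp only [ae_all_iff]
    intro n k hn hb
    have hbd := ae_bdd_abs_condExp_of_ae_bdd_abs (m := m) (μ := ν) (f := f n - g)
      (R := 1 / ((k : ℝ) + 1)) (Eventually.of_forall hb)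
    filter_upwards [hbd, condExp_sub hn hg m] with ω h1 h2
    rw [h2] at h1
    exact h1
  filter_upwards [key] with ω hω
  rw [Metric.tendsto_nhds]
  intro ε hε
  obtain ⟨k, hk⟩ := exists_nat_one_div_lt hε
  filter_upwards [hf, Metric.tendstoUniformly_iff.mp hfg (1 / ((k : ℝ) + 1)) (by positivity)]
    with n hn hu
  refine (hω n k hn fun x => ?_).trans_lt hk
  rw [← Real.dist_eq, dist_comm]
  exact (hu x).le

/-- for a bounded measurable `ξ`, a sub-σ-algebra `𝒢` and any
sequence `γ_n ↓ 0` of positive reals along which `exp_q(-γ_n ξ)` is well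
defined, the conditional certainty equivalents
`-(1/γ_n) ln_q(E_ν[exp_q(-γ_n ξ) | 𝒢])` converge `ν`-a.s. to `E_ν[ξ | 𝒢]`. -/
theorem conditional_certainty_equivalent_small_gamma_limit
    {Ω : Type*} {m0 : MeasurableSpace Ω}
    (m : MeasurableSpace Ω) (hm : m ≤ m0)
    (ν : @MeasureTheory.Measure Ω m0) [IsProbabilityMeasure ν]
    (q : ℝ) (hq : 0 < q) (hq1 : q ≠ 1)
    (ξ : Ω → ℝ) (hξ : @Measurable Ω ℝ m0 _ ξ)
    (C : ℝ) (hC : ∀ ω, |ξ ω| ≤ C)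
    (γ : ℕ → ℝ) (hγpos : ∀ n, 0 < γ n)
    (hγ0 : Tendsto γ atTop (nhds 0))
    (hwd : ∀ n ω, 0 < 1 + (1 - q) * (-(γ n) * ξ ω)) :
    ∀ᵐ ω ∂ν,
      Tendsto
        (fun n =>
          -(1 / γ n) * lnq q ((ν[(fun ω' => expq q (-(γ n) * ξ ω')) | m]) ω))
        atTop (nhds ((ν[ξ | m]) ω)) := by
  have hξi : Integrable ξ ν :=
    Integrable.of_bound hξ.aestronglyMeasurable C (Eventually.of_forall hC)
  have hexp0 : expq q 0 = 1 := by simp [expq]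
  have hunif := tendstoUniformly_sub_div_of_hasDerivAt (hasDerivAt_expq_zero hq1) hC hγpos hγ0
  rw [hexp0] at hunif
  set f : ℕ → Ω → ℝ := fun n ω => (1 - expq q (-(γ n) * ξ ω)) / γ n with hf
  have hmeas (n : ℕ) : Measurable[m0] (f n) :=
    ((((hξ.const_mul (-(γ n))).const_mul (1 - q)).const_add 1).pow_const
      (1 / (1 - q))).const_sub 1 |>.div_const (γ n)
  have hint : ∀ᶠ n in atTop, Integrable (f n) ν := by
    filter_upwards [Metric.tendstoUniformly_iff.mp hunif 1 one_pos] with n hn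
    refine Integrable.of_bound (hmeas n).aestronglyMeasurable (C + 1)
      (Eventually.of_forall fun ω => ?_)
    have h1 := abs_lt.mp (hn ω)
    have h2 := abs_le.mp (hC ω)
    exact abs_le.mpr ⟨by linarith, by linarith⟩
  have hcond : ∀ᵐ ω ∂ν, ∀ n, Integrable (f n) ν →
      (ν[(fun ω' => expq q (-(γ n) * ξ ω')) | m]) ω = 1 - γ n * (ν[f n | m]) ω := by
    simp only [ae_all_iff]
    intro n hn
    have heq : (fun ω' => expq q (-(γ n) * ξ ω')) = (fun _ => (1 : ℝ)) - γ n • f n := by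
      ext ω
      have := (hγpos n).ne'
      simp only [hf, Pi.sub_apply, Pi.smul_apply, smul_eq_mul]
      field_simp
      ring
    rw [heq]
    filter_upwards [condExp_sub (integrable_const (1 : ℝ)) (hn.smul (γ n)) m,
      condExp_smul (γ n) (f n) m (μ := ν)] with ω h1 h2
    rw [h1, Pi.sub_apply, h2, condExp_const hm]
    simp
  filter_upwards [hunif.ae_tendsto_condExp (m := m) hint hξi, hcond] with ω h1 h2
  refine (tendsto_neg_inv_mul_lnq hq1 hγpos hγ0 h1).congr' ?_
  filter_upwards [hint] with n hn
  rw [h2 n hn]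
end
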